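/- arXiv:1701.00388 — 2 statements merged into one kernel-verified Lean document; each statement's English description precedes it below -/
import Mathlib

section
/- For every positive integer $k$, $\sum_{n=1}^{\infty} \frac{H_n^3 - 3H_n\zeta_n(2) + 2\zeta_n(3)}{n(n+k)} = \frac{1}{k}\left\{ \frac{H_k^4 + 8H_k\zeta_k(3) + 6H_k^2\zeta_k(2) + 3\zeta_k^2(2) + 6\zeta_k(4)}{4} - \frac{H_k^3 + 3H_k\zeta_k(2) + 2\zeta_k(3)}{k} + 6\zeta(4) \right\}$. -/
noncomputable def H (n : ℕ) : ℝ := ∑ j ∈ Finset.Icc 1 n, (1 : ℝ) / j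

noncomputable def zh (m n : ℕ) : ℝ := ∑ j ∈ Finset.Icc 1 n, (1 : ℝ) / (j : ℝ) ^ m

open Filter Topology

/-- Elementary symmetric sums of `1, 1/2, ..., 1/n`. -/
noncomputable def eS : ℕ → ℕ → ℝ
  | 0, _ => 1
  | _ + 1, 0 => 0
  | m + 1, n + 1 => eS (m + 1) n + eS m n / ((n : ℝ) + 1)

/-- Complete homogeneous sums of `1, 1/2, ..., 1/n`. -/
noncomputable def hS : ℕ → ℕ → ℝ
  | 0, _ => 1
  | _ + 1, 0 => 0
  | m + 1, n + 1 => hS (m + 1) n + hS m (n + 1) / ((n : ℝ) + 1)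

lemma _root_.HasSum.congr_fun_aux {f g : ℕ → ℝ} {s : ℝ} (h : HasSum f s) (hfg : ∀ n, g n = f n) :
    HasSum g s := by
  rwa [funext hfg]

lemma eS_zero (n : ℕ) : eS 0 n = 1 := by simp [eS]
lemma eS_succ_zero (m : ℕ) : eS (m + 1) 0 = 0 := by simp [eS]
lemma eS_succ_succ (m n : ℕ) :
    eS (m + 1) (n + 1) = eS (m + 1) n + eS m n / ((n : ℝ) + 1) := by simp [eS]
lemma hS_zero (n : ℕ) : hS 0 n = 1 := by cases n <;> simp [hS]
lemma hS_succ_zero (m : ℕ) : hS (m + 1) 0 = 0 := by simp [hS]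
lemma hS_succ_succ (m n : ℕ) :
    hS (m + 1) (n + 1) = hS (m + 1) n + hS m (n + 1) / ((n : ℝ) + 1) := by
  rw [hS]

lemma eS_nonneg (m n : ℕ) : 0 ≤ eS m n := by
  induction m generalizing n with
  | zero => simp [eS_zero]
  | succ m ih =>
    induction n with
    | zero => simp [eS_succ_zero]
    | succ n ihn =>
      rw [eS_succ_succ]
      have := ih n
      positivity

lemma eS_eq_sum (m n : ℕ) : eS (m + 1) n = ∑ i ∈ Finset.range n, eS m i / ((i : ℝ) + 1) := by
  induction n with
  | zero => simp [eS_succ_zero]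
  | succ n ih => rw [eS_succ_succ, Finset.sum_range_succ, ih]

lemma tendsto_eS (m : ℕ) : Tendsto (fun n : ℕ => eS m n * (1 / (n : ℝ))) atTop (𝓝 0) := by
  induction m with
  | zero => simpa [eS_zero] using tendsto_one_div_atTop_nhds_zero_nat (𝕜 := ℝ)
  | succ m ih =>
    have h1 : Tendsto (fun n : ℕ => eS m n / ((n : ℝ) + 1)) atTop (𝓝 0) := by
      refine tendsto_of_tendsto_of_tendsto_of_le_of_le' tendsto_const_nhds ih ?_ ?_
      · filter_upwards with n
        have := eS_nonneg m n
        positivity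
      · filter_upwards [eventually_gt_atTop 0] with n hn
        have hn' : (0 : ℝ) < n := by exact_mod_cast hn
        rw [div_eq_mul_one_div]
        apply mul_le_mul_of_nonneg_left _ (eS_nonneg m n)
        apply one_div_le_one_div_of_le hn'
        linarith
    have h2 := h1.cesaro
    refine h2.congr fun n => ?_
    rw [eS_eq_sum, mul_comm, one_div]

lemma tendsto_eS_of_le (m : ℕ) (c : ℕ → ℝ) (h0 : ∀ n, 0 ≤ c n)
    (h1 : ∀ n : ℕ, 0 < n → c n ≤ 1 / (n : ℝ)) :
    Tendsto (fun n : ℕ => eS m n * c n) atTop (𝓝 0) := by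
  refine tendsto_of_tendsto_of_tendsto_of_le_of_le' tendsto_const_nhds (tendsto_eS m) ?_ ?_
  · filter_upwards with n
    exact mul_nonneg (eS_nonneg m n) (h0 n)
  · filter_upwards [eventually_gt_atTop 0] with n hn
    exact mul_le_mul_of_nonneg_left (h1 n hn) (eS_nonneg m n)

/-- Abel summation. -/
lemma abel_sum (u c : ℕ → ℝ) (s : ℝ) (h0 : ∀ n, 0 ≤ u n * (c n - c (n + 1)))
    (hs : HasSum (fun n => (u (n + 1) - u n) * c (n + 1)) s)
    (ht : Tendsto (fun n => u n * c n) atTop (𝓝 0)) :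
    HasSum (fun n => u n * (c n - c (n + 1))) (s + u 0 * c 0) := by
  rw [hasSum_iff_tendsto_nat_of_nonneg h0]
  have h1 := (hs.tendsto_sum_nat.add_const (u 0 * c 0)).sub ht
  rw [sub_zero] at h1
  refine h1.congr fun N => ?_
  induction N with
  | zero => simp
  | succ N ih => rw [Finset.sum_range_succ, Finset.sum_range_succ, ← ih]; ring

lemma abel_eS_zero (c : ℕ → ℝ) (h0 : ∀ n, 0 ≤ c n) (h1 : ∀ n : ℕ, 0 < n → c n ≤ 1 / (n : ℝ))
    (hc : ∀ n, c (n + 1) ≤ c n) :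
    HasSum (fun n => eS 0 n * (c n - c (n + 1))) (c 0) := by
  have := abel_sum (eS 0) c 0 (fun n => mul_nonneg (eS_nonneg _ _) (sub_nonneg.2 (hc n)))
    (by simpa [eS_zero] using hasSum_zero) (tendsto_eS_of_le 0 c h0 h1)
  simpa [eS_zero] using this

lemma abel_eS_succ (m : ℕ) (c : ℕ → ℝ) (s : ℝ) (h0 : ∀ n, 0 ≤ c n)
    (h1 : ∀ n : ℕ, 0 < n → c n ≤ 1 / (n : ℝ))
    (hc : ∀ n, 0 < n → c (n + 1) ≤ c n)
    (hs : HasSum (fun n : ℕ => eS m n / ((n : ℝ) + 1) * c (n + 1)) s) :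
    HasSum (fun n => eS (m + 1) n * (c n - c (n + 1))) s := by
  have := abel_sum (eS (m + 1)) c s ?_ ?_ (tendsto_eS_of_le (m + 1) c h0 h1)
  · simpa [eS_succ_zero] using this
  · intro n
    rcases Nat.eq_zero_or_pos n with rfl | hn
    · simp [eS_succ_zero]
    · exact mul_nonneg (eS_nonneg _ _) (sub_nonneg.2 (hc n hn))
  · refine hs.congr_fun_aux fun n => ?_
    rw [eS_succ_succ]; ring

/-- The connector. -/
noncomputable def conn (a b : ℕ) : ℝ := (a.factorial : ℝ) * b.factorial / (a + b).factorial

lemma conn_nonneg (a b : ℕ) : 0 ≤ conn a b := by unfold conn; positivity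

lemma conn_comm (a b : ℕ) : conn a b = conn b a := by
  unfold conn; rw [add_comm a b]; ring

lemma conn_succ (a b : ℕ) : conn a (b + 1) = conn a b * (((b : ℝ) + 1) / (a + b + 1)) := by
  unfold conn
  rw [← add_assoc, Nat.factorial_succ, Nat.factorial_succ]
  have := Nat.factorial_pos (a + b)
  push_cast
  field_simp

lemma conn_zero (a : ℕ) : conn a 0 = 1 := by
  unfold conn
  have : (a.factorial : ℝ) ≠ 0 := by exact_mod_cast (Nat.factorial_pos a).ne'
  simp [this]

lemma conn_succ_le (a b : ℕ) : conn a (b + 1) ≤ conn a b := by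
  rw [conn_succ]
  apply mul_le_of_le_one_right (conn_nonneg a b)
  rw [div_le_one (by positivity)]
  have : (0 : ℝ) ≤ a := by positivity
  linarith

lemma conn_sub (a b : ℕ) :
    conn (a + 1) b - conn (a + 1) (b + 1) = ((a : ℝ) + 1) * (1 / ((b : ℝ) + 1) * conn (a + 1) (b + 1)) := by
  rw [conn_succ]
  push_cast
  field_simp
  ring

lemma conn_le (a n : ℕ) (hn : 0 < n) : conn (a + 1) n ≤ 1 / (n : ℝ) := by
  induction a with
  | zero =>
    rw [conn_comm, conn_succ, conn_zero]
    have hn' : (0 : ℝ) < n := by exact_mod_cast hn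
    simp only [one_mul]
    push_cast
    rw [div_le_div_iff₀ (by positivity) hn']
    linarith
  | succ a ih =>
    refine le_trans ?_ ih
    rw [conn_comm, conn_comm (a + 1)]
    exact conn_succ_le _ _

lemma conn_sum (m a : ℕ) :
    HasSum (fun b : ℕ => eS m b / ((b : ℝ) + 1) * conn (a + 1) (b + 1))
      (1 / ((a : ℝ) + 1) ^ (m + 1)) := by
  have key : ∀ m s, HasSum (fun n => eS m n * (conn (a + 1) n - conn (a + 1) (n + 1))) s →
      HasSum (fun b : ℕ => eS m b / ((b : ℝ) + 1) * conn (a + 1) (b + 1)) (1 / ((a : ℝ) + 1) * s) := by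
    intro m s hs
    refine (hs.mul_left (1 / ((a : ℝ) + 1))).congr_fun_aux fun n => ?_
    rw [conn_sub]
    have : (a : ℝ) + 1 ≠ 0 := by positivity
    field_simp
  induction m with
  | zero =>
    have := key _ _ (abel_eS_zero _ (conn_nonneg (a + 1)) (conn_le a) (conn_succ_le (a + 1)))
    simpa [conn_zero] using this
  | succ m ih =>
    have := key _ _ (abel_eS_succ m _ _ (conn_nonneg (a + 1)) (conn_le a)
      (fun n _ => conn_succ_le (a + 1) n) ih)
    convert this using 1
    rw [pow_succ]
    field_simp

lemma zeta_dual : HasSum (fun b : ℕ => eS 2 b / ((b : ℝ) + 1) * (1 / ((b : ℝ) + 1)))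
    (Real.pi ^ 4 / 90) := by
  have hz : HasSum (fun a : ℕ => 1 / ((a : ℝ) + 1) ^ 4) (Real.pi ^ 4 / 90) := by
    have := (hasSum_nat_add_iff' 1).2 hasSum_zeta_four
    simpa using this
  set F : ℕ × ℕ → ℝ := fun p =>
    1 / ((p.1 : ℝ) + 1) * (eS 2 p.2 / ((p.2 : ℝ) + 1) * conn (p.1 + 1) (p.2 + 1)) with hF
  have hF0 : 0 ≤ F := fun p => by
    have := eS_nonneg 2 p.2
    have := conn_nonneg (p.1 + 1) (p.2 + 1)
    simp only [hF, Pi.zero_apply]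
    positivity
  have hrow : ∀ a : ℕ, HasSum (fun b => F (a, b)) (1 / ((a : ℝ) + 1) ^ 4) := by
    intro a
    have := (conn_sum 2 a).mul_left (1 / ((a : ℝ) + 1))
    have he : 1 / ((a : ℝ) + 1) ^ 4 = 1 / ((a : ℝ) + 1) * (1 / ((a : ℝ) + 1) ^ (2 + 1)) := by
      field_simp
    rw [he]
    exact this
  have hcol : ∀ b : ℕ, HasSum (fun a => F (a, b))
      (eS 2 b / ((b : ℝ) + 1) * (1 / ((b : ℝ) + 1))) := by
    intro b
    have := (conn_sum 0 b).mul_left (eS 2 b / ((b : ℝ) + 1))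
    simp only [zero_add, pow_one] at this
    refine this.congr_fun_aux fun a => ?_
    simp only [hF, eS_zero]
    rw [conn_comm]
    ring
  have hsum : Summable F := by
    rw [summable_prod_of_nonneg hF0]
    refine ⟨fun a => (hrow a).summable, ?_⟩
    refine hz.summable.congr fun a => ?_
    exact (hrow a).tsum_eq.symm
  have h1 := hsum.hasSum.prod_fiberwise hrow
  have h2 : HasSum F (Real.pi ^ 4 / 90) := by
    rw [← h1.unique hz]; exact hsum.hasSum
  have h3 : HasSum (F ∘ (Equiv.prodComm ℕ ℕ)) (Real.pi ^ 4 / 90) :=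
    (Equiv.prodComm ℕ ℕ).hasSum_iff.2 h2
  exact h3.prod_fiberwise hcol

lemma inv_c (j : ℕ) (m : ℕ) (s : ℝ)
    (hs : HasSum (fun n : ℕ => eS m n * (1 / ((n : ℝ) + 1) - 1 / ((n : ℝ) + 1 + (j + 1)))) s) :
    HasSum (fun n : ℕ => eS (m + 1) n * (1 / ((n : ℝ) + 1 + j) - 1 / ((n : ℝ) + 1 + (j + 1))))
      (s / ((j : ℝ) + 1)) := by
  have := abel_eS_succ m (fun n => 1 / ((n : ℝ) + 1 + j)) (s / ((j : ℝ) + 1)) ?_ ?_ ?_ ?_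
  · refine this.congr_fun_aux fun n => ?_
    push_cast
    congr 3
    ring
  · intro n; positivity
  · intro n hn
    have hn' : (0 : ℝ) < n := by exact_mod_cast hn
    have : (0 : ℝ) ≤ j := by positivity
    apply one_div_le_one_div_of_le hn'
    linarith
  · intro n hn
    apply one_div_le_one_div_of_le (by positivity)
    push_cast
    linarith
  · refine (hs.div_const ((j : ℝ) + 1)).congr_fun_aux fun n => ?_
    push_cast
    field_simp
    ring

lemma sumA (m j : ℕ) :
    HasSum (fun n : ℕ => eS m n * (1 / ((n : ℝ) + 1) - 1 / ((n : ℝ) + 1 + j))) (hS (m + 1) j) := by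
  induction m generalizing j with
  | zero =>
    induction j with
    | zero => simpa [hS_succ_zero] using hasSum_zero
    | succ j ih =>
      have h := abel_eS_zero (fun n => 1 / ((n : ℝ) + 1 + j)) ?_ ?_ ?_
      · rw [hS_succ_succ, hS_zero]
        have h2 := ih.add h
        convert h2 using 1
        · funext n
          push_cast
          ring
        · push_cast; ring
      · intro n; positivity
      · intro n hn
        have hn' : (0 : ℝ) < n := by exact_mod_cast hn
        have : (0 : ℝ) ≤ j := by positivity
        apply one_div_le_one_div_of_le hn'
        linarith
      · intro n
        apply one_div_le_one_div_of_le (by positivity)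
        push_cast
        linarith
  | succ m ihm =>
    induction j with
    | zero => simpa [hS_succ_zero] using hasSum_zero
    | succ j ih =>
      have h := inv_c j m _ (by simpa using ihm (j + 1))
      rw [hS_succ_succ]
      refine (ih.add h).congr_fun_aux fun n => ?_
      push_cast
      ring

lemma sumB (j : ℕ) :
    HasSum (fun n : ℕ => eS 3 n * (1 / (n : ℝ) - 1 / ((n : ℝ) + 1 + j)))
      (Real.pi ^ 4 / 90 + hS 4 j) := by
  induction j with
  | zero =>
    have := abel_eS_succ 2 (fun n => 1 / (n : ℝ)) _ (fun n => by positivity) (fun n _ => le_rfl) ?_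
      (by simpa using zeta_dual)
    · simpa [hS_succ_zero] using this
    · intro n hn
      have hn' : (0 : ℝ) < n := by exact_mod_cast hn
      apply one_div_le_one_div_of_le hn'
      push_cast
      linarith
  | succ j ih =>
    have h := inv_c j 2 _ (by simpa using sumA 2 (j + 1))
    rw [hS_succ_succ, ← add_assoc]
    refine (ih.add h).congr_fun_aux fun n => ?_
    push_cast
    ring

lemma H_succ (n : ℕ) : H (n + 1) = H n + 1 / ((n : ℝ) + 1) := by
  unfold H; rw [Finset.sum_Icc_succ_top (by omega)]; push_cast; rfl
lemma zh_succ (m n : ℕ) : zh m (n + 1) = zh m n + 1 / ((n : ℝ) + 1) ^ m := by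
  unfold zh; rw [Finset.sum_Icc_succ_top (by omega)]; push_cast; rfl
lemma H_zero : H 0 = 0 := by simp [H]
lemma zh_zero (m : ℕ) : zh m 0 = 0 := by simp [zh]

lemma e1 (n : ℕ) : eS 1 n = H n := by
  induction n with
  | zero => simp [eS_succ_zero, H_zero]
  | succ n ih => rw [eS_succ_succ, ih, H_succ, eS_zero]
lemma e2 (n : ℕ) : eS 2 n = (H n ^ 2 - zh 2 n) / 2 := by
  induction n with
  | zero => simp [eS_succ_zero, H_zero, zh_zero]
  | succ n ih => rw [eS_succ_succ, ih, H_succ, zh_succ, e1]; field_simp; ring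
lemma e3 (n : ℕ) : eS 3 n = (H n ^ 3 - 3 * H n * zh 2 n + 2 * zh 3 n) / 6 := by
  induction n with
  | zero => simp [eS_succ_zero, H_zero, zh_zero]
  | succ n ih => rw [eS_succ_succ, ih, H_succ, zh_succ, zh_succ, e2]; field_simp; ring

lemma h1 (n : ℕ) : hS 1 n = H n := by
  induction n with
  | zero => simp [hS_succ_zero, H_zero]
  | succ n ih => rw [hS_succ_succ, ih, H_succ, hS_zero]
lemma h2 (n : ℕ) : hS 2 n = (H n ^ 2 + zh 2 n) / 2 := by
  induction n with
  | zero => simp [hS_succ_zero, H_zero, zh_zero]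
  | succ n ih => rw [hS_succ_succ, ih, h1, H_succ, zh_succ]; field_simp; ring
lemma h3 (n : ℕ) : hS 3 n = (H n ^ 3 + 3 * H n * zh 2 n + 2 * zh 3 n) / 6 := by
  induction n with
  | zero => simp [hS_succ_zero, H_zero, zh_zero]
  | succ n ih => rw [hS_succ_succ, ih, h2, H_succ, zh_succ, zh_succ]; field_simp; ring
lemma h4 (n : ℕ) : hS 4 n = (H n ^ 4 + 8 * H n * zh 3 n + 6 * H n ^ 2 * zh 2 n +
    3 * zh 2 n ^ 2 + 6 * zh 4 n) / 24 := by
  induction n with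
  | zero => simp [hS_succ_zero, H_zero, zh_zero]
  | succ n ih =>
    rw [hS_succ_succ, ih, h3, H_succ, zh_succ, zh_succ, zh_succ]; field_simp; ring

theorem stmt4 (k : ℕ) (hk : 0 < k) :
    ∑' n : ℕ,
        (H (n + 1) ^ 3 - 3 * H (n + 1) * zh 2 (n + 1) + 2 * zh 3 (n + 1)) /
          (((n : ℝ) + 1) * ((n : ℝ) + 1 + k)) =
      (1 / (k : ℝ)) *
        ((H k ^ 4 + 8 * H k * zh 3 k + 6 * H k ^ 2 * zh 2 k + 3 * zh 2 k ^ 2 + 6 * zh 4 k) / 4 -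
          (H k ^ 3 + 3 * H k * zh 2 k + 2 * zh 3 k) / k + 6 * (Real.pi ^ 4 / 90)) := by
  obtain ⟨j, rfl⟩ : ∃ j, k = j + 1 := ⟨k - 1, by omega⟩
  have hB := (hasSum_nat_add_iff' 1).2 (sumB j)
  simp only [Finset.sum_range_one, eS_succ_zero, zero_mul, sub_zero] at hB
  have hB2 := hB.mul_left (6 / ((j : ℝ) + 1))
  have hh : hS 4 j = hS 4 (j + 1) - hS 3 (j + 1) / ((j : ℝ) + 1) := by
    rw [hS_succ_succ]; ring
  have hfin : HasSum (fun n : ℕ =>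
      (H (n + 1) ^ 3 - 3 * H (n + 1) * zh 2 (n + 1) + 2 * zh 3 (n + 1)) /
          (((n : ℝ) + 1) * ((n : ℝ) + 1 + ((j + 1 : ℕ) : ℝ))))
      (6 / ((j : ℝ) + 1) * (Real.pi ^ 4 / 90 + hS 4 j)) := by
    refine hB2.congr_fun_aux fun n => ?_
    rw [e3]
    push_cast
    field_simp
    ring
  rw [hfin.tsum_eq, hh, h4, h3]
  push_cast
  field_simp
  ring
end

section
/- For integers $p \geq 2$ and $k \geq 1$, $(p-1)!\sum_{n=p-1}^{\infty} \frac{S(n+1,p)}{n!\,n(n+k)} = \frac{1}{k}\left\{ (p-1)!\,\zeta(p) + \frac{Y_p(k)}{p} - \frac{Y_{p-1}(k)}{k} \right\}$. -/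
noncomputable def Y : ℕ → ℕ → ℝ
  | 0, _ => 1
  | k + 1, n => ((k : ℝ) + 1) * ∑ m ∈ Finset.Icc 1 n, Y k m / m

/-- Unsigned Stirling numbers of the first kind:
`(x+1)(x+2)⋯(x+n) = ∑ₖ stirling1 (n+1) (k+1) xᵏ`. -/
def stirling1 : ℕ → ℕ → ℕ
  | 0, 0 => 1
  | 0, _ + 1 => 0
  | _ + 1, 0 => 0
  | n + 1, k + 1 => n * stirling1 n (k + 1) + stirling1 n k

noncomputable def Z (s : ℕ) : ℝ := ∑' n : ℕ, 1 / ((n : ℝ) + 1) ^ s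

open Filter Topology

lemma hs {f g : ℕ → ℝ} {a b : ℝ} (h : HasSum f a) (hf : ∀ n, g n = f n) (hb : b = a) :
    HasSum g b := by
  rw [hb, funext hf]; exact h

lemma swap_hasSum (f : ℕ → ℕ → ℝ) (hf : ∀ n m, 0 ≤ f n m) (c r : ℕ → ℝ) (S : ℝ)
    (hc : ∀ m, HasSum (fun n => f n m) (c m)) (hr : ∀ n, HasSum (fun m => f n m) (r n))
    (hS : HasSum c S) : HasSum r S := by
  have h1 : Summable (fun x : ℕ × ℕ => f x.2 x.1) := by
    rw [summable_prod_of_nonneg (fun x => hf _ _)]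
    refine ⟨fun m => (hc m).summable, ?_⟩
    have : (fun m => ∑' n, f n m) = c := funext fun m => (hc m).tsum_eq
    simpa [this] using hS.summable
  have h2 : HasSum (fun x : ℕ × ℕ => f x.2 x.1) S := by
    have := h1.hasSum.prod_fiberwise (g := c) (fun m => hc m)
    rw [← this.unique hS]; exact h1.hasSum
  have h3 : HasSum (fun x : ℕ × ℕ => f x.1 x.2) S :=
    (Equiv.prodComm ℕ ℕ).hasSum_iff.mp (by simpa [Function.comp_def] using h2)
  exact h3.prod_fiberwise (fun n => hr n)

lemma telescope (t : ℕ → ℝ) (ht : Antitone t) (h0 : Tendsto t atTop (𝓝 0)) :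
    HasSum (fun n => t n - t (n + 1)) (t 0) := by
  rw [hasSum_iff_tendsto_nat_of_nonneg (fun n => sub_nonneg.2 (ht (Nat.le_succ n)))]
  simp_rw [Finset.sum_range_sub']
  simpa using h0.const_sub (t 0)

noncomputable def aa (q n : ℕ) : ℝ := (stirling1 (n + 1) (q + 1) : ℝ) / (n.factorial : ℝ)

lemma aa_nonneg (q n : ℕ) : 0 ≤ aa q n := by unfold aa; positivity

lemma stir_zero (n k : ℕ) (h : n < k) : stirling1 n k = 0 := by
  induction n generalizing k with
  | zero => obtain _ | k := k <;> simp_all [stirling1]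
  | succ n ih =>
    obtain _ | k := k
    · omega
    · simp [stirling1, ih (k + 1) (by omega), ih k (by omega)]

lemma aa_succ (q n : ℕ) : aa (q + 1) (n + 1) = aa (q + 1) n + aa q n / (n + 1) := by
  have h : stirling1 (n + 2) (q + 2) = (n + 1) * stirling1 (n + 1) (q + 2) + stirling1 (n + 1) (q + 1) := rfl
  have : (n.factorial : ℝ) ≠ 0 := by positivity
  have : (n : ℝ) + 1 ≠ 0 := by positivity
  simp only [aa, Nat.factorial_succ]
  rw [h]
  push_cast
  field_simp

lemma aa_zero_left (n : ℕ) : aa 0 n = 1 := by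
  have : ∀ n, stirling1 (n + 1) 1 = n.factorial := by
    intro n
    induction n with
    | zero => rfl
    | succ n ih =>
      have h : stirling1 (n + 2) 1 = (n + 1) * stirling1 (n + 1) 1 + stirling1 (n + 1) 0 := rfl
      have h' : stirling1 (n + 1) 0 = 0 := rfl
      rw [h, ih, h', Nat.factorial_succ]; rfl
  have h2 : (n.factorial : ℝ) ≠ 0 := by positivity
  simp [aa, this, h2]

lemma aa_lt (q n : ℕ) (h : n < q) : aa q n = 0 := by
  simp [aa, stir_zero (n + 1) (q + 1) (by omega)]

lemma aa_sum (q n : ℕ) : aa (q + 1) n = ∑ l ∈ Finset.range n, aa q l / (l + 1) := by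
  induction n with
  | zero => simp [aa_lt]
  | succ n ih => rw [aa_succ, Finset.sum_range_succ, ih]

lemma abel (q : ℕ) (t : ℕ → ℝ) (S : ℝ) (ht : Antitone t) (h0 : Tendsto t atTop (𝓝 0))
    (h : HasSum (fun l : ℕ => aa q l / (l + 1) * t l) S) :
    HasSum (fun n : ℕ => aa (q + 1) (n + 1) * (t n - t (n + 1))) S := by
  refine swap_hasSum (fun n l => if l ≤ n then aa q l / (l + 1) * (t n - t (n + 1)) else 0)
    ?_ _ _ S ?_ ?_ h
  · intro n m
    split_ifs
    · have := aa_nonneg q m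
      have := sub_nonneg.2 (ht (Nat.le_succ n))
      simp only [Nat.succ_eq_add_one] at this
      positivity
    · rfl
  · intro l
    rw [← hasSum_nat_add_iff' l]
    have h1 : ∑ i ∈ Finset.range l,
        (if l ≤ i then aa q l / (l + 1) * (t i - t (i + 1)) else 0) = 0 := by
      apply Finset.sum_eq_zero
      intro i hi
      rw [if_neg]; have := Finset.mem_range.1 hi; omega
    rw [h1, sub_zero]
    have h2 := telescope (fun n => t (n + l)) (fun a b hab => ht (by omega))
      ((tendsto_add_atTop_iff_nat l).2 h0)
    have h3 := h2.mul_left (aa q l / (l + 1))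
    simp only [zero_add] at h3
    refine hs h3 (fun n => ?_) rfl
    rw [if_pos (by omega), show n + l + 1 = n + 1 + l by omega]
  · intro n
    rw [aa_sum, Finset.sum_mul]
    have := hasSum_sum_of_ne_finset_zero (L := SummationFilter.unconditional ℕ) (s := Finset.range (n + 1))
      (f := fun l : ℕ => if l ≤ n then aa q l / (l + 1) * (t n - t (n + 1)) else 0) (by
        intro b hb
        rw [if_neg]; simp at hb; omega)
    convert this using 1
    apply Finset.sum_congr rfl
    intro i hi
    rw [if_pos]; simp at hi; omega

lemma shift0 (f : ℕ → ℝ) (S : ℝ) (h0 : f 0 = 0) (h : HasSum (fun n => f (n + 1)) S) :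
    HasSum f S := by
  rw [← hasSum_nat_add_iff' 1]; simpa [h0] using h

/-- complete homogeneous normalisation -/
noncomputable def yy (q k : ℕ) : ℝ := Y q k / (q.factorial : ℝ)

lemma yy_zero (k : ℕ) : yy 0 k = 1 := by simp [yy, Y]

lemma yy_sum (q k : ℕ) : yy (q + 1) k = ∑ m ∈ Finset.Icc 1 k, yy q m / m := by
  have : (q.factorial : ℝ) ≠ 0 := by positivity
  have h2 : (q : ℝ) + 1 ≠ 0 := by positivity
  simp only [yy, Y, Nat.factorial_succ]
  push_cast
  rw [mul_div_mul_left _ _ h2, Finset.sum_div]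
  apply Finset.sum_congr rfl
  intro m _
  ring

lemma yy_succ (q k : ℕ) : yy (q + 1) (k + 1) = yy (q + 1) k + yy q (k + 1) / ((k : ℝ) + 1) := by
  rw [yy_sum, yy_sum, Finset.sum_Icc_succ_top (by omega)]; push_cast; rfl

lemma anti_inv (k : ℕ) : Antitone (fun n : ℕ => 1 / ((n : ℝ) + k + 1)) := by
  intro a b hab
  have : (a : ℝ) ≤ b := by exact_mod_cast hab
  dsimp only
  gcongr

lemma tend_inv (k : ℕ) : Tendsto (fun n : ℕ => 1 / ((n : ℝ) + k + 1)) atTop (𝓝 0) := by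
  have := (tendsto_add_atTop_iff_nat k).2 (tendsto_one_div_add_atTop_nhds_zero_nat (𝕜 := ℝ))
  simpa using this

lemma PP (q : ℕ) : ∀ k : ℕ, HasSum (fun n : ℕ => aa q n *
    (1 / ((n : ℝ) + k + 1) - 1 / ((n : ℝ) + k + 2))) (yy q (k + 1) / ((k : ℝ) + 1)) := by
  induction q with
  | zero =>
    intro k
    have := telescope _ (anti_inv k) (tend_inv k)
    simp only [aa_zero_left, yy_zero, one_mul]
    refine hs this (fun n => ?_) ?_
    · push_cast; ring
    · simp
  | succ q ih =>
    have key : ∀ k : ℕ, HasSum (fun l : ℕ => aa q l * (1 / ((l : ℝ) + 1) - 1 / ((l : ℝ) + k + 1)))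
        (yy (q + 1) k) := by
      intro k
      induction k with
      | zero => simp [yy_sum, hasSum_zero]
      | succ k ihk =>
        rw [yy_succ]
        refine hs (ihk.add (ih k)) (fun l => ?_) rfl
        push_cast; ring
    intro k
    apply shift0
    · simp [aa_lt]
    · have h := (key (k + 1)).div_const ((k : ℝ) + 1)
      have h2 := abel q _ (yy (q + 1) (k + 1) / ((k : ℝ) + 1)) (anti_inv (k + 1)) (tend_inv (k + 1)) (by
        refine hs h (fun l => ?_) rfl
        have : (k : ℝ) + 1 ≠ 0 := by positivity
        have : (l : ℝ) + 1 ≠ 0 := by positivity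
        have : (l : ℝ) + (k + 1) + 1 ≠ 0 := by positivity
        push_cast
        field_simp
        ring)
      refine hs h2 (fun n => ?_) rfl
      push_cast
      ring

/-- connector -/
noncomputable def CC (n m : ℕ) : ℝ := (n.factorial : ℝ) * m.factorial / ((n + m).factorial : ℝ)

lemma CC_comm (n m : ℕ) : CC n m = CC m n := by
  simp only [CC, add_comm n m]; ring

lemma CC_pos (n m : ℕ) : 0 < CC n m := by unfold CC; positivity

lemma CC_step (n m : ℕ) : 1 / ((m : ℝ) + 1) * CC n (m + 1) - 1 / ((m : ℝ) + 1) * CC (n + 1) (m + 1)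
    = CC (n + 1) (m + 1) / ((n : ℝ) + 1) := by
  have h : n + 1 + (m + 1) = (n + (m + 1)) + 1 := by omega
  have h1 : ((n + (m + 1)).factorial : ℝ) ≠ 0 := by positivity
  have h2 : (m : ℝ) + 1 ≠ 0 := by positivity
  have h3 : (n : ℝ) + 1 ≠ 0 := by positivity
  have h4 : (n : ℝ) + (m + 1) + 1 ≠ 0 := by positivity
  simp only [CC, h, Nat.factorial_succ (n + (m + 1)), Nat.factorial_succ n]
  push_cast
  field_simp
  ring

lemma CC_le (n m : ℕ) : CC n (m + 1) ≤ 1 / ((n : ℝ) + 1) := by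
  have hn : CC n 1 = 1 / ((n : ℝ) + 1) := by
    have h1 : (n.factorial : ℝ) ≠ 0 := by positivity
    have h3 : (n : ℝ) + 1 ≠ 0 := by positivity
    simp only [CC, Nat.factorial_succ n]
    push_cast
    simp
    field_simp
  induction m with
  | zero => exact hn.le
  | succ m ih =>
    refine le_trans ?_ ih
    obtain _ | n := n
    · simp [CC, Nat.factorial_ne_zero]
    · have h := CC_step (m + 1) n
      have h2 : 0 < CC (m + 1 + 1) (n + 1) / (((m + 1 : ℕ) : ℝ) + 1) := by
        have := CC_pos (m + 1 + 1) (n + 1); positivity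
      rw [← h, ← mul_sub] at h2
      have h3 := pos_of_mul_pos_right h2 (by positivity)
      rw [CC_comm (n + 1), CC_comm (n + 1)]
      linarith

lemma CC_anti (m : ℕ) : Antitone (fun n : ℕ => 1 / ((m : ℝ) + 1) * CC n (m + 1)) := by
  apply antitone_nat_of_succ_le
  intro n
  have := CC_step n m
  have : 0 < CC (n + 1) (m + 1) / ((n : ℝ) + 1) := by
    have := CC_pos (n + 1) (m + 1); positivity
  linarith

lemma CC_tend (m : ℕ) : Tendsto (fun n : ℕ => 1 / ((m : ℝ) + 1) * CC n (m + 1)) atTop (𝓝 0) := by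
  have : Tendsto (fun n : ℕ => CC n (m + 1)) atTop (𝓝 0) :=
    squeeze_zero (fun n => (CC_pos _ _).le) (fun n => CC_le n m)
      (tendsto_one_div_add_atTop_nhds_zero_nat (𝕜 := ℝ))
  simpa using this.const_mul (1 / ((m : ℝ) + 1))

lemma CC_sum (m : ℕ) : HasSum (fun l : ℕ => CC (l + 1) (m + 1) / ((l : ℝ) + 1)) (1 / ((m : ℝ) + 1)) := by
  have := telescope _ (CC_anti m) (CC_tend m)
  simp only [CC_step] at this
  convert this using 1
  simp [CC, Nat.factorial_ne_zero]

lemma QQ (q m : ℕ) : HasSum (fun l : ℕ => aa q l / (l + 1) * CC (l + 1) (m + 1))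
    (1 / ((m : ℝ) + 1) ^ (q + 1)) := by
  induction q with
  | zero =>
    refine hs (CC_sum m) (fun l => ?_) ?_
    · rw [aa_zero_left]; ring
    · simp
  | succ q ih =>
    apply shift0
    · simp [aa_lt]
    · have h := abel q (fun n : ℕ => 1 / ((m : ℝ) + 1) * CC (n + 1) (m + 1))
        (1 / ((m : ℝ) + 1) * (1 / ((m : ℝ) + 1) ^ (q + 1)))
        (fun a b hab => CC_anti m (by omega)) ((tendsto_add_atTop_iff_nat 1).2 (CC_tend m)) (by
          refine hs (ih.mul_left (1 / ((m : ℝ) + 1))) (fun l => ?_) rfl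
          ring)
      refine hs h (fun n => ?_) ?_
      · rw [CC_step]; push_cast; ring
      · rw [pow_succ _ (q + 1)]; field_simp

lemma ZZ (q : ℕ) : HasSum (fun l : ℕ => aa q l / (l + 1) * (1 / ((l : ℝ) + 1))) (Z (q + 2)) := by
  refine swap_hasSum (fun l m => aa q l / (l + 1) * (CC (l + 1) (m + 1) / ((m : ℝ) + 1))) ?_
    (fun m => 1 / ((m : ℝ) + 1) ^ (q + 2)) _ _ ?_ ?_ ?_
  · intro n m
    have := aa_nonneg q n
    have := CC_pos (n + 1) (m + 1)
    positivity
  · intro m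
    refine hs ((QQ q m).div_const ((m : ℝ) + 1)) (fun l => ?_) ?_
    · ring
    · rw [pow_succ _ (q + 1)]; field_simp
  · intro n
    apply HasSum.mul_left
    refine hs (CC_sum n) (fun l => ?_) rfl
    rw [CC_comm]
  · have h := (summable_nat_add_iff 1).2 (Real.summable_one_div_nat_pow.2 (show 1 < q + 2 by omega))
    have h2 : Summable (fun m : ℕ => 1 / ((m : ℝ) + 1) ^ (q + 2)) := by simpa using h
    exact h2.hasSum

lemma FF (q k : ℕ) : HasSum (fun n : ℕ => aa (q + 1) (n + 1) *
    (1 / ((n : ℝ) + 1) - 1 / ((n : ℝ) + k + 2))) (Z (q + 2) + yy (q + 2) k) := by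
  induction k with
  | zero =>
    have := abel q _ (Z (q + 2)) (anti_inv 0) (tend_inv 0) (by simpa using ZZ q)
    refine hs this (fun n => ?_) ?_
    · push_cast; ring
    · simp [yy_sum]
  | succ k ih =>
    rw [yy_succ, ← add_assoc]
    have h : HasSum (fun n : ℕ => aa (q + 1) (n + 1) *
       (1 / (((n + 1 : ℕ) : ℝ) + k + 1) - 1 / (((n + 1 : ℕ) : ℝ) + k + 2)))
       (yy (q + 1) (k + 1) / ((k : ℝ) + 1)) := by
      have := (hasSum_nat_add_iff' 1).2 (PP (q + 1) k)
      simpa [aa_lt] using this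
    refine hs (ih.add h) (fun n => ?_) rfl
    push_cast; ring

theorem stmt13 (p k : ℕ) (hp : 2 ≤ p) (hk : 1 ≤ k) :
    ((p - 1).factorial : ℝ) *
        ∑' i : ℕ,
          (stirling1 (i + p) p : ℝ) /
            (((i + p - 1).factorial : ℝ) * ((i : ℝ) + p - 1) * ((i : ℝ) + p - 1 + k)) =
      (1 / (k : ℝ)) *
        (((p - 1).factorial : ℝ) * Z p + Y p k / p - Y (p - 1) k / k) := by
  obtain ⟨q, rfl⟩ := Nat.exists_eq_add_of_le' hp
  obtain ⟨k, rfl⟩ := Nat.exists_eq_add_of_le' hk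
  have h := (hasSum_nat_add_iff' q).2 (FF q k)
  have h0 : ∑ i ∈ Finset.range q, aa (q + 1) (i + 1) *
    (1 / ((i : ℝ) + 1) - 1 / ((i : ℝ) + k + 2)) = 0 := by
    apply Finset.sum_eq_zero
    intro i hi
    have := Finset.mem_range.1 hi
    rw [aa_lt _ _ (by omega), zero_mul]
  rw [h0, sub_zero] at h
  have hk0 : (k : ℝ) + 1 ≠ 0 := by positivity
  have h2 := h.div_const ((k : ℝ) + 1)
  have h3 : HasSum (fun i : ℕ => (stirling1 (i + (q + 2)) (q + 2) : ℝ) /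
            (((i + (q + 2) - 1).factorial : ℝ) * ((i : ℝ) + (q + 2 : ℕ) - 1) *
              ((i : ℝ) + (q + 2 : ℕ) - 1 + (k + 1 : ℕ)))) ((Z (q + 2) + yy (q + 2) k) / ((k : ℝ) + 1)) := by
    refine hs h2 (fun i => ?_) rfl
    rw [show i + (q + 2) - 1 = i + q + 1 by omega]
    simp only [aa]
    rw [show i + q + 1 + 1 = i + (q + 2) by omega, show q + 1 + 1 = q + 2 by omega]
    have e1 : ((i + q + 1).factorial : ℝ) ≠ 0 := by positivity
    have e2 : (i : ℝ) + q + 1 ≠ 0 := by positivity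
    have e3 : (i : ℝ) + q + k + 2 ≠ 0 := by positivity
    push_cast
    rw [show (i : ℝ) + (q + 2) - 1 + (k + 1) = i + q + k + 2 by ring,
      show (i : ℝ) + (q + 2) - 1 = i + q + 1 by ring]
    field_simp
    ring
  rw [h3.tsum_eq]
  have h4 := yy_succ (q + 1) k
  have h5 : yy (q + 2) k = yy (q + 2) (k + 1) - yy (q + 1) (k + 1) / ((k : ℝ) + 1) := by
    linarith
  rw [h5]
  rw [show q + 2 - 1 = q + 1 by omega]
  simp only [yy, Nat.factorial_succ (q + 1)]
  have e1 : ((q + 1).factorial : ℝ) ≠ 0 := by positivity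
  have e2 : (q : ℝ) + 2 ≠ 0 := by positivity
  have e3 : (q : ℝ) + 1 + 1 ≠ 0 := by positivity
  push_cast
  rw [show (q : ℝ) + 1 + 1 = q + 2 by ring]
  field_simp
  ring
end
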